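/- arXiv:0910.3325 — 2 statements merged into one kernel-verified Lean document; each statement's English description precedes it below -/
import Mathlib

section
/- Define I_β = √(β/(2π)) ∫_{−∞}^{∞} e^{−β(cosh t − 1)} dt for β > 0. Then I_β < 1 for every β > 0. -/
open Real MeasureTheory

/-- The one-site integral `I_β = √(β/(2π)) ∫_ℝ e^{-β(cosh t - 1)} dt`. -/
noncomputable def Ibeta (β : ℝ) : ℝ :=
  Real.sqrt (β / (2 * π)) * ∫ t : ℝ, Real.exp (-β * (Real.cosh t - 1))

theorem hasDerivAt_sinh_half (t : ℝ) :
    HasDerivAt (fun t : ℝ => Real.sinh (t / 2)) (Real.cosh (t / 2) / 2) t := by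
  simpa [div_eq_mul_inv] using ((hasDerivAt_id t).div_const 2).sinh

theorem bijective_sinh_half : Function.Bijective (fun t : ℝ => Real.sinh (t / 2)) :=
  Real.sinh_bijective.comp (mulRight_bijective₀ (2⁻¹ : ℝ) (by norm_num))

theorem cosh_sub_one_eq_sinh_half_sq (t : ℝ) :
    Real.cosh t - 1 = 2 * Real.sinh (t / 2) ^ 2 := by
  have h := Real.cosh_two_mul (t / 2)
  rw [mul_div_cancel₀ t two_ne_zero, Real.cosh_sq] at h
  linarith

theorem integrable_cosh_half_mul_exp {β : ℝ} (hβ : 0 < β) :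
    Integrable fun t : ℝ => Real.cosh (t / 2) * Real.exp (-β * (Real.cosh t - 1)) := by
  have h := (integrableOn_image_iff_integrableOn_abs_deriv_smul MeasurableSet.univ
    (fun t _ => (hasDerivAt_sinh_half t).hasDerivWithinAt) bijective_sinh_half.injective.injOn
    (fun u : ℝ => Real.exp (-(2 * β) * u ^ 2))).1
    (integrable_exp_neg_mul_sq (by positivity)).integrableOn
  rw [integrableOn_univ] at h
  refine (h.const_mul 2).congr (.of_forall fun t => ?_)
  have ht := Real.cosh_pos (t / 2)
  simp only [cosh_sub_one_eq_sinh_half_sq, smul_eq_mul, abs_of_pos (half_pos ht)]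
  ring_nf

theorem integral_cosh_half_mul_exp {β : ℝ} (hβ : 0 < β) :
    ∫ t : ℝ, Real.cosh (t / 2) * Real.exp (-β * (Real.cosh t - 1)) = √(2 * π / β) := by
  have h := integral_image_eq_integral_abs_deriv_smul MeasurableSet.univ
    (fun t _ => (hasDerivAt_sinh_half t).hasDerivWithinAt) bijective_sinh_half.injective.injOn
    (fun u : ℝ => Real.exp (-(2 * β) * u ^ 2))
  rw [Set.image_univ, bijective_sinh_half.surjective.range_eq, setIntegral_univ,
    setIntegral_univ, integral_gaussian] at h
  calc
    _ = ∫ t : ℝ, 2 * (|Real.cosh (t / 2) / 2| • Real.exp (-(2 * β) * Real.sinh (t / 2) ^ 2)) := by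
      congr 1 with t
      have ht := Real.cosh_pos (t / 2)
      simp only [cosh_sub_one_eq_sinh_half_sq, smul_eq_mul, abs_of_pos (half_pos ht)]
      ring_nf
    _ = 2 * √(π / (2 * β)) := by rw [integral_const_mul, ← h]
    _ = √(2 * π / β) := by
      rw [show 2 * π / β = 2 ^ 2 * (π / (2 * β)) by field_simp,
        Real.sqrt_mul (by positivity), Real.sqrt_sq (by positivity)]

theorem integral_exp_lt_integral_cosh_half_mul_exp {β : ℝ} (hβ : 0 < β) :
    ∫ t : ℝ, Real.exp (-β * (Real.cosh t - 1)) <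
      ∫ t : ℝ, Real.cosh (t / 2) * Real.exp (-β * (Real.cosh t - 1)) := by
  have hg := integrable_cosh_half_mul_exp hβ
  have hle (t : ℝ) : Real.exp (-β * (Real.cosh t - 1)) ≤
      Real.cosh (t / 2) * Real.exp (-β * (Real.cosh t - 1)) :=
    le_mul_of_one_le_left (Real.exp_pos _).le (Real.one_le_cosh _)
  have hf : Integrable fun t : ℝ => Real.exp (-β * (Real.cosh t - 1)) :=
    hg.mono' (by fun_prop) (.of_forall fun t => by simpa using hle t)
  rw [← sub_pos, ← integral_sub hg hf]
  refine integral_pos_of_integrable_nonneg_nonzero (x := 1) (by fun_prop) (hg.sub hf)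
    (fun t => sub_nonneg.2 (hle t)) (sub_pos.2 ?_).ne'
  exact lt_mul_of_one_lt_left (Real.exp_pos _) (Real.one_lt_cosh.2 (by norm_num))

/-- `I_β < 1` for every `β > 0`. -/
theorem Ibeta_lt_one (β : ℝ) (hβ : 0 < β) : Ibeta β < 1 := by
  have h := integral_exp_lt_integral_cosh_half_mul_exp hβ
  rw [integral_cosh_half_mul_exp hβ] at h
  calc
    Ibeta β < √(β / (2 * π)) * √(2 * π / β) :=
      mul_lt_mul_of_pos_left h (Real.sqrt_pos.2 (by positivity))
    _ = 1 := by
      rw [← Real.sqrt_mul (by positivity), div_mul_div_cancel₀ (by positivity),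
        div_self hβ.ne', Real.sqrt_one]
end

section
/- Define I_β = √(β/(2π)) ∫_{−∞}^{∞} e^{−β(cosh t − 1)} dt for β > 0. Then for every β with 0 < β < 0.15 one has I_β ≤ √β · ln(1/β). -/
open Real MeasureTheory

open Set

/-- Degree seven Taylor polynomial of `exp` evaluated at `y / 8`. -/
noncomputable def expTaylor (y : ℝ) : ℝ :=
  ∑ m ∈ Finset.range 8, (y / 8) ^ m / (m.factorial : ℝ)

/-- Remainder bound for `expTaylor`. -/
noncomputable def expRemainder (y : ℝ) : ℝ :=
  |y / 8| ^ 8 * (9 / 322560)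

lemma exp_eq_pow_eight (y : ℝ) : Real.exp y = Real.exp (y / 8) ^ 8 := by
  rw [← Real.exp_nat_mul]
  congr 1
  push_cast
  ring

lemma abs_exp_sub_expTaylor_le {y : ℝ} (hy : |y / 8| ≤ 1) :
    |Real.exp (y / 8) - expTaylor y| ≤ expRemainder y := by
  have h := Real.exp_bound hy (n := 8) (by norm_num)
  refine h.trans_eq ?_
  norm_num [expRemainder, Nat.factorial]

lemma exp_le_expTaylor_add_pow {y : ℝ} (hy : |y / 8| ≤ 1) :
    Real.exp y ≤ (expTaylor y + expRemainder y) ^ 8 := by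
  have h := (abs_le.1 (abs_exp_sub_expTaylor_le hy)).2
  rw [exp_eq_pow_eight y]
  exact pow_le_pow_left₀ (Real.exp_pos _).le (by linarith) 8

lemma expTaylor_sub_pow_le_exp {y : ℝ} (hy : |y / 8| ≤ 1)
    (h0 : 0 ≤ expTaylor y - expRemainder y) :
    (expTaylor y - expRemainder y) ^ 8 ≤ Real.exp y := by
  have h := (abs_le.1 (abs_exp_sub_expTaylor_le hy)).1
  rw [exp_eq_pow_eight y]
  exact pow_le_pow_left₀ h0 (by linarith) 8

/-- The tangent line of `cosh` at `log r`, with `l` in place of `log r`. -/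
noncomputable def coshTangent (r l t : ℝ) : ℝ :=
  (r + r⁻¹) / 2 + (r - r⁻¹) / 2 * (t - l)

lemma sub_inv_pos_of_one_lt {r : ℝ} (hr : 1 < r) : 0 < r - r⁻¹ :=
  sub_pos.2 ((inv_lt_one_of_one_lt₀ hr).trans hr)

lemma coshTangent_le_cosh {r l : ℝ} (hr : 1 < r) (hl : r ≤ Real.exp l) (t : ℝ) :
    coshTangent r l t ≤ Real.cosh t := by
  have hr0 : 0 < r := by linarith
  have hlog : Real.log r ≤ l := (Real.log_le_iff_le_exp hr0).2 hl
  have h₁ : r * (1 + (t - Real.log r)) ≤ Real.exp t := by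
    have h := Real.add_one_le_exp (t - Real.log r)
    rw [Real.exp_sub, Real.exp_log hr0, le_div_iff₀ hr0] at h
    linarith
  have h₂ : r⁻¹ * (1 - (t - Real.log r)) ≤ Real.exp (-t) := by
    have h := Real.add_one_le_exp (-t + Real.log r)
    rw [Real.exp_add, Real.exp_log hr0, ← div_le_iff₀ hr0] at h
    calc r⁻¹ * (1 - (t - Real.log r)) = (-t + Real.log r + 1) / r := by ring
      _ ≤ _ := h
  have h₃ : 0 ≤ (r - r⁻¹) * (l - Real.log r) :=
    mul_nonneg (sub_inv_pos_of_one_lt hr).le (by linarith)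
  rw [Real.cosh_eq, coshTangent]
  linarith

lemma exp_neg_mul_cosh_le {β r l : ℝ} (hβ : 0 < β) (hr : 1 < r) (hl : r ≤ Real.exp l) (t : ℝ) :
    Real.exp (-β * (Real.cosh t - 1)) ≤ Real.exp (-β * (coshTangent r l t - 1)) := by
  have h := mul_le_mul_of_nonneg_left (coshTangent_le_cosh hr hl t) hβ.le
  exact Real.exp_le_exp.2 (by linarith)

lemma exp_neg_mul_coshTangent_eq (β r l t : ℝ) :
    Real.exp (-β * (coshTangent r l t - 1)) =
      Real.exp (-β * (coshTangent r l 0 - 1)) * Real.exp (-(β * ((r - r⁻¹) / 2)) * t) := by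
  rw [← Real.exp_add]
  congr 1
  unfold coshTangent
  ring

lemma integrableOn_exp_neg_mul_coshTangent {β r : ℝ} (hβ : 0 < β) (hr : 1 < r) (l a : ℝ) :
    IntegrableOn (fun t => Real.exp (-β * (coshTangent r l t - 1))) (Ioi a) := by
  have hS := sub_inv_pos_of_one_lt hr
  rw [funext (exp_neg_mul_coshTangent_eq β r l)]
  exact (integrableOn_exp_mul_Ioi (by simpa using by positivity) a).const_mul _

lemma integrableOn_exp_neg_mul_cosh {β : ℝ} (hβ : 0 < β) (a : ℝ) :
    IntegrableOn (fun t => Real.exp (-β * (Real.cosh t - 1))) (Ioi a) := by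
  have hl : (2 : ℝ) ≤ Real.exp 1 := by linarith [Real.add_one_le_exp (1 : ℝ)]
  refine (integrableOn_exp_neg_mul_coshTangent hβ one_lt_two 1 a).mono' ?_ ?_
  · exact (by fun_prop : Continuous fun t : ℝ =>
      Real.exp (-β * (Real.cosh t - 1))).aestronglyMeasurable
  · refine Filter.Eventually.of_forall fun t => ?_
    rw [Real.norm_of_nonneg (Real.exp_pos _).le]
    exact exp_neg_mul_cosh_le hβ one_lt_two hl t

lemma integral_Ioi_exp_neg_mul_cosh_le {β r l : ℝ} (hβ : 0 < β) (hr : 1 < r)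
    (hl : r ≤ Real.exp l) (a : ℝ) :
    ∫ t in Ioi a, Real.exp (-β * (Real.cosh t - 1)) ≤
      Real.exp (-β * (coshTangent r l a - 1)) / (β * ((r - r⁻¹) / 2)) := by
  have hS := sub_inv_pos_of_one_lt hr
  refine (setIntegral_mono (integrableOn_exp_neg_mul_cosh hβ a)
    (integrableOn_exp_neg_mul_coshTangent hβ hr l a)
    (exp_neg_mul_cosh_le hβ hr hl)).trans_eq ?_
  rw [exp_neg_mul_coshTangent_eq β r l a, funext (exp_neg_mul_coshTangent_eq β r l),
    integral_const_mul, integral_exp_mul_Ioi (by simpa using by positivity), neg_div_neg_eq,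
    mul_div_assoc]

lemma intervalIntegral_exp_neg_mul_cosh_le {β r l a b : ℝ} (hβ : 0 < β) (hr : 1 < r)
    (hl : r ≤ Real.exp l) (hab : a ≤ b) :
    ∫ t in a..b, Real.exp (-β * (Real.cosh t - 1)) ≤
      (Real.exp (-β * (coshTangent r l a - 1)) - Real.exp (-β * (coshTangent r l b - 1))) /
        (β * ((r - r⁻¹) / 2)) := by
  have hS := sub_inv_pos_of_one_lt hr
  have hint := integrableOn_exp_neg_mul_coshTangent hβ hr l
  have hcosh : Continuous fun t : ℝ => Real.exp (-β * (Real.cosh t - 1)) := by fun_prop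
  have htangent : Continuous fun t : ℝ => Real.exp (-β * (coshTangent r l t - 1)) := by
    unfold coshTangent
    fun_prop
  refine (intervalIntegral.integral_mono_on hab (hcosh.intervalIntegrable _ _)
    (htangent.intervalIntegrable _ _)
    (fun t _ => exp_neg_mul_cosh_le hβ hr hl t)).trans_eq ?_
  rw [eq_sub_iff_add_eq.2 (intervalIntegral.integral_interval_add_Ioi (hint a) (hint b)),
    exp_neg_mul_coshTangent_eq β r l a, exp_neg_mul_coshTangent_eq β r l b,
    funext (exp_neg_mul_coshTangent_eq β r l), integral_const_mul, integral_const_mul,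
    integral_exp_mul_Ioi (by simpa using by positivity),
    integral_exp_mul_Ioi (by simpa using by positivity), neg_div_neg_eq, neg_div_neg_eq]
  ring

lemma intervalIntegral_exp_neg_mul_cosh_le_of_expTaylor {β r l a b v : ℝ} (hβ : 0 < β)
    (hr : 1 < r) (hab : a ≤ b)
    (hl : |l / 8| ≤ 1) (hl0 : 0 ≤ expTaylor l - expRemainder l)
    (hrl : r ≤ (expTaylor l - expRemainder l) ^ 8)
    (ha : |-β * (coshTangent r l a - 1) / 8| ≤ 1) (hb : |-β * (coshTangent r l b - 1) / 8| ≤ 1)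
    (hb0 : 0 ≤ expTaylor (-β * (coshTangent r l b - 1)) -
      expRemainder (-β * (coshTangent r l b - 1)))
    (hv : (expTaylor (-β * (coshTangent r l a - 1)) +
        expRemainder (-β * (coshTangent r l a - 1))) ^ 8 -
      (expTaylor (-β * (coshTangent r l b - 1)) -
        expRemainder (-β * (coshTangent r l b - 1))) ^ 8 ≤ v * (β * ((r - r⁻¹) / 2))) :
    ∫ t in a..b, Real.exp (-β * (Real.cosh t - 1)) ≤ v := by
  have hS := sub_inv_pos_of_one_lt hr
  refine (intervalIntegral_exp_neg_mul_cosh_le hβ hr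
    (hrl.trans (expTaylor_sub_pow_le_exp hl hl0)) hab).trans ?_
  rw [div_le_iff₀ (by positivity)]
  linarith [exp_le_expTaylor_add_pow ha, expTaylor_sub_pow_le_exp hb hb0]

lemma integral_Ioi_exp_neg_mul_cosh_le_of_expTaylor {β r l a v : ℝ} (hβ : 0 < β)
    (hr : 1 < r) (hl : |l / 8| ≤ 1) (hl0 : 0 ≤ expTaylor l - expRemainder l)
    (hrl : r ≤ (expTaylor l - expRemainder l) ^ 8)
    (ha : |-β * (coshTangent r l a - 1) / 8| ≤ 1)
    (hv : (expTaylor (-β * (coshTangent r l a - 1)) +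
      expRemainder (-β * (coshTangent r l a - 1))) ^ 8 ≤ v * (β * ((r - r⁻¹) / 2))) :
    ∫ t in Ioi a, Real.exp (-β * (Real.cosh t - 1)) ≤ v := by
  have hS := sub_inv_pos_of_one_lt hr
  refine (integral_Ioi_exp_neg_mul_cosh_le hβ hr
    (hrl.trans (expTaylor_sub_pow_le_exp hl hl0)) a).trans ?_
  rw [div_le_iff₀ (by positivity)]
  exact (exp_le_expTaylor_add_pow ha).trans hv

/-- The half-line integral at the endpoint `β = 3 / 20`; its true value is about `2.3585`. -/
lemma integral_Ioi_exp_neg_mul_cosh_three_div_twenty_le :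
    ∫ t in Ioi (0 : ℝ), Real.exp (-(3 / 20) * (Real.cosh t - 1)) ≤ 2.371 := by
  have hc : Continuous fun t : ℝ => Real.exp (-(3 / 20) * (Real.cosh t - 1)) := by fun_prop
  have hi : ∀ a b : ℝ, IntervalIntegrable
      (fun t : ℝ => Real.exp (-(3 / 20) * (Real.cosh t - 1))) volume a b :=
    fun a b => hc.intervalIntegrable a b
  have h0 : ∫ t in (0 : ℝ)..(1 / 2), Real.exp (-(3 / 20) * (Real.cosh t - 1)) ≤ 0.4977 := by
    apply intervalIntegral_exp_neg_mul_cosh_le_of_expTaylor (r := 13 / 10) (l := 0.263) <;>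
      norm_num [coshTangent, expTaylor, expRemainder, Finset.sum_range_succ, Nat.factorial,
        abs_div]
  have h1 : ∫ t in (1 / 2 : ℝ)..1, Real.exp (-(3 / 20) * (Real.cosh t - 1)) ≤ 0.4785 := by
    apply intervalIntegral_exp_neg_mul_cosh_le_of_expTaylor (r := 21 / 10) (l := 0.742) <;>
      norm_num [coshTangent, expTaylor, expRemainder, Finset.sum_range_succ, Nat.factorial,
        abs_div]
  have h2 : ∫ t in (1 : ℝ)..(3 / 2), Real.exp (-(3 / 20) * (Real.cosh t - 1)) ≤ 0.4380 := by
    apply intervalIntegral_exp_neg_mul_cosh_le_of_expTaylor (r := 35 / 10) (l := 1.253) <;>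
      norm_num [coshTangent, expTaylor, expRemainder, Finset.sum_range_succ, Nat.factorial,
        abs_div]
  have h3 : ∫ t in (3 / 2 : ℝ)..2, Real.exp (-(3 / 20) * (Real.cosh t - 1)) ≤ 0.3732 := by
    apply intervalIntegral_exp_neg_mul_cosh_le_of_expTaylor (r := 57 / 10) (l := 1.741) <;>
      norm_num [coshTangent, expTaylor, expRemainder, Finset.sum_range_succ, Nat.factorial,
        abs_div]
  have h4 : ∫ t in (2 : ℝ)..(5 / 2), Real.exp (-(3 / 20) * (Real.cosh t - 1)) ≤ 0.2845 := by
    apply intervalIntegral_exp_neg_mul_cosh_le_of_expTaylor (r := 94 / 10) (l := 2.241) <;>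
      norm_num [coshTangent, expTaylor, expRemainder, Finset.sum_range_succ, Nat.factorial,
        abs_div]
  have h5 : ∫ t in (5 / 2 : ℝ)..3, Real.exp (-(3 / 20) * (Real.cosh t - 1)) ≤ 0.1814 := by
    apply intervalIntegral_exp_neg_mul_cosh_le_of_expTaylor (r := 153 / 10) (l := 2.728) <;>
      norm_num [coshTangent, expTaylor, expRemainder, Finset.sum_range_succ, Nat.factorial,
        abs_div]
  have h6 : ∫ t in (3 : ℝ)..(7 / 2), Real.exp (-(3 / 20) * (Real.cosh t - 1)) ≤ 0.0870 := by
    apply intervalIntegral_exp_neg_mul_cosh_le_of_expTaylor (r := 248 / 10) (l := 3.211) <;>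
      norm_num [coshTangent, expTaylor, expRemainder, Finset.sum_range_succ, Nat.factorial,
        abs_div]
  have h7 : ∫ t in (7 / 2 : ℝ)..4, Real.exp (-(3 / 20) * (Real.cosh t - 1)) ≤ 0.0264 := by
    apply intervalIntegral_exp_neg_mul_cosh_le_of_expTaylor (r := 400 / 10) (l := 3.689) <;>
      norm_num [coshTangent, expTaylor, expRemainder, Finset.sum_range_succ, Nat.factorial,
        abs_div]
  have h8 : ∫ t in Ioi (4 : ℝ), Real.exp (-(3 / 20) * (Real.cosh t - 1)) ≤ 0.0043 := by
    apply integral_Ioi_exp_neg_mul_cosh_le_of_expTaylor (r := 667 / 10) (l := 4.201) <;>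
      norm_num [coshTangent, expTaylor, expRemainder, Finset.sum_range_succ, Nat.factorial,
        abs_div]
  rw [← intervalIntegral.integral_interval_add_Ioi' (hi 0 4)
    (integrableOn_exp_neg_mul_cosh (by norm_num) 4)]
  rw [← intervalIntegral.integral_add_adjacent_intervals (hi 0 (7 / 2)) (hi (7 / 2) 4)]
  rw [← intervalIntegral.integral_add_adjacent_intervals (hi 0 3) (hi 3 (7 / 2))]
  rw [← intervalIntegral.integral_add_adjacent_intervals (hi 0 (5 / 2)) (hi (5 / 2) 3)]
  rw [← intervalIntegral.integral_add_adjacent_intervals (hi 0 2) (hi 2 (5 / 2))]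
  rw [← intervalIntegral.integral_add_adjacent_intervals (hi 0 (3 / 2)) (hi (3 / 2) 2)]
  rw [← intervalIntegral.integral_add_adjacent_intervals (hi 0 1) (hi 1 (3 / 2))]
  rw [← intervalIntegral.integral_add_adjacent_intervals (hi 0 (1 / 2)) (hi (1 / 2) 1)]
  linarith

lemma exp_mul_cosh_sub_one_le {s t : ℝ} (hs : 0 ≤ s) (ht : 0 ≤ t) :
    Real.exp s * (Real.cosh t - 1) ≤ Real.cosh (t + s) - 1 := by
  have h₁ : Real.exp (-(t + s)) = Real.exp (-t) * Real.exp (-s) := by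
    rw [← Real.exp_add]
    ring_nf
  have h₂ : Real.exp s * Real.exp (-s) = 1 := by rw [← Real.exp_add]; simp
  have h₃ : Real.exp (-t) ≤ 1 := Real.exp_le_one_iff.2 (by linarith)
  have h₄ : Real.exp (-s) ≤ Real.exp s := Real.exp_le_exp.2 (by linarith)
  rw [Real.cosh_eq, Real.cosh_eq, Real.exp_add, h₁]
  nlinarith [mul_nonneg (sub_nonneg.2 h₃) (sub_nonneg.2 h₄), sq_nonneg (Real.exp s - 1),
    Real.add_one_le_exp s, Real.add_one_le_exp (-s)]

lemma integral_Ioi_exp_neg_mul_cosh_le_add_log {β b : ℝ} (hβ : 0 < β) (hb : β ≤ b) :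
    ∫ t in Ioi (0 : ℝ), Real.exp (-β * (Real.cosh t - 1)) ≤
      Real.log (b / β) + ∫ t in Ioi (0 : ℝ), Real.exp (-b * (Real.cosh t - 1)) := by
  have hb0 : 0 < b := hβ.trans_le hb
  set s := Real.log (b / β) with hs
  have hs0 : 0 ≤ s := Real.log_nonneg ((one_le_div₀ hβ).2 hb)
  have hbs : b = β * Real.exp s := by
    rw [hs, Real.exp_log (by positivity)]
    field_simp
  have hc : Continuous fun t : ℝ => Real.exp (-β * (Real.cosh t - 1)) := by fun_prop
  have hshift : (fun t : ℝ => t + s) ⁻¹' Ioi s = Ioi 0 := by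
    ext t
    simp
  rw [← intervalIntegral.integral_interval_add_Ioi' (hc.intervalIntegrable 0 s)
    (integrableOn_exp_neg_mul_cosh hβ s)]
  refine add_le_add ?_ ?_
  · calc ∫ t in (0 : ℝ)..s, Real.exp (-β * (Real.cosh t - 1))
        ≤ ∫ _ in (0 : ℝ)..s, (1 : ℝ) := by
          refine intervalIntegral.integral_mono_on hs0 (hc.intervalIntegrable _ _)
            intervalIntegrable_const fun t _ => Real.exp_le_one_iff.2 ?_
          have := mul_nonneg hβ.le (sub_nonneg.2 (Real.one_le_cosh t))
          linarith
      _ = s := by simp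
  · have hpre := (measurePreserving_add_right volume s).setIntegral_preimage_emb
      (measurableEmbedding_addRight s) (fun t => Real.exp (-β * (Real.cosh t - 1))) (Ioi s)
    have hint := ((measurePreserving_add_right volume s).integrableOn_comp_preimage
      (measurableEmbedding_addRight s)).2 (integrableOn_exp_neg_mul_cosh hβ s)
    rw [hshift] at hpre hint
    rw [← hpre]
    refine setIntegral_mono_on hint (integrableOn_exp_neg_mul_cosh hb0 0) measurableSet_Ioi
      fun t ht => Real.exp_le_exp.2 ?_
    have h := mul_le_mul_of_nonneg_left (exp_mul_cosh_sub_one_le hs0 (le_of_lt ht)) hβ.le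
    rw [← mul_assoc, ← hbs] at h
    linarith

lemma log_twenty_div_three_ge : 1.8971 ≤ Real.log (20 / 3) := by
  rw [Real.le_log_iff_exp_le (by norm_num)]
  refine (exp_le_expTaylor_add_pow ?_).trans ?_ <;>
  norm_num [expTaylor, expRemainder, Finset.sum_range_succ, Nat.factorial, abs_div]

lemma sqrt_two_pi_ge : 2.506 ≤ Real.sqrt (2 * π) :=
  Real.le_sqrt_of_sq_le (by linarith [Real.pi_gt_d4])

/-- For `0 < β < 0.15` one has `I_β ≤ √β · ln(1/β)`. -/
theorem Ibeta_le_sqrt_mul_log (β : ℝ) (hβ : 0 < β) (hβ' : β < 0.15) :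
    Ibeta β ≤ Real.sqrt β * Real.log (1 / β) := by
  have hβ'' : β ≤ 3 / 20 := by norm_num at hβ' ⊢; exact hβ'.le
  have heven : ∫ t : ℝ, Real.exp (-β * (Real.cosh t - 1)) =
      2 * ∫ t in Ioi (0 : ℝ), Real.exp (-β * (Real.cosh t - 1)) := by
    rw [← integral_comp_abs (f := fun t => Real.exp (-β * (Real.cosh t - 1)))]
    simp only [Real.cosh_abs]
  have hlog : Real.log (1 / β) = Real.log (3 / 20 / β) + Real.log (20 / 3) := by
    rw [← Real.log_mul (by positivity) (by norm_num)]
    congr 1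
    field_simp
  have hlog0 : 0 ≤ Real.log (3 / 20 / β) := Real.log_nonneg ((one_le_div₀ hβ).2 hβ'')
  have hpi := sqrt_two_pi_ge
  have hpi0 : 0 < Real.sqrt (2 * π) := by positivity
  rw [Ibeta, heven, Real.sqrt_div hβ.le, div_mul_eq_mul_div, mul_div_assoc]
  refine mul_le_mul_of_nonneg_left ?_ (Real.sqrt_nonneg β)
  rw [div_le_iff₀ hpi0, hlog]
  have h₁ := integral_Ioi_exp_neg_mul_cosh_le_add_log hβ hβ''
  have h₂ := integral_Ioi_exp_neg_mul_cosh_three_div_twenty_le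
  have h₃ : 2.506 * (Real.log (3 / 20 / β) + 1.8971) ≤
      (Real.log (3 / 20 / β) + Real.log (20 / 3)) * Real.sqrt (2 * π) := by
    rw [mul_comm]
    exact mul_le_mul (by linarith [log_twenty_div_three_ge]) hpi (by norm_num)
      (by linarith [log_twenty_div_three_ge])
  linarith
end
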